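/- arXiv:1912.06241 — 2 statements merged into one kernel-verified Lean document; each statement's English description precedes it below -/
import Mathlib

section
/- Let N ≥ 4 be even, let λ ∈ {−1,1}^N satisfy λ_1 + ⋯ + λ_N = 0, and let v_1,…,v_N ∈ ℤ^{N−1} be the columns of the facet matrix V(λ). Then there exists x ∈ (ℂ∖{0})^{N−1} satisfying the vector equation ∑_{k=1}^N x^{v_k} · v_k = 0 in ℂ^{N−1} if and only if N is divisible by 4. -/
noncomputable section

/-- The monomial `x^v = ∏_j x_j^{v_j}` (integer exponents). -/
def mpow {n : ℕ} (x : Fin n → ℂ) (v : Fin n → ℤ) : ℂ := ∏ j, x j ^ v j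

/-- The facet matrix `V(λ)`: its `k`-th column (`k = 1, …, N`) is `λ_k (e_{k-1} − e_k)`,
with `e_0 = e_N = 0`. -/
def facetV (N : ℕ) (lam : Fin N → ℤ) : Matrix (Fin (N - 1)) (Fin N) ℤ :=
  Matrix.of fun r k =>
    lam k * ((if (r : ℕ) + 1 = (k : ℕ) then 1 else 0) - (if (r : ℕ) = (k : ℕ) then 1 else 0))

/-- The coordinates of `x`, shifted by one and extended by `1`: for `x : Fin n → ℂ` this is
`x_{i-1}` if `1 ≤ i ≤ n` and `1` otherwise. -/
def extendOne {n : ℕ} (x : Fin n → ℂ) (i : ℕ) : ℂ :=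
  ∏ r : Fin n, if (r : ℕ) + 1 = i then x r else 1

lemma extendOne_zero {n : ℕ} (x : Fin n → ℂ) : extendOne x 0 = 1 := by
  simp [extendOne]

lemma extendOne_succ {n : ℕ} (x : Fin n → ℂ) (r : Fin n) : extendOne x (r + 1) = x r := by
  simp [extendOne, Fin.val_inj]

lemma extendOne_last {n : ℕ} (x : Fin n → ℂ) : extendOne x (n + 1) = 1 :=
  Finset.prod_eq_one fun r _ => if_neg (by omega)

lemma extendOne_ne_zero {n : ℕ} {x : Fin n → ℂ} (hx : ∀ j, x j ≠ 0) (i : ℕ) :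
    extendOne x i ≠ 0 := by
  refine Finset.prod_ne_zero_iff.2 fun r _ => ?_
  split_ifs
  exacts [hx r, one_ne_zero]

lemma mpow_facetV {n : ℕ} {x : Fin n → ℂ} (hx : ∀ j, x j ≠ 0) (lam : Fin (n + 1) → ℤ)
    (k : Fin (n + 1)) :
    mpow x (fun r => facetV (n + 1) lam r k) =
      (extendOne x k / extendOne x (k + 1)) ^ lam k := by
  rw [mpow, extendOne, extendOne, ← Finset.prod_div_distrib, ← Finset.prod_zpow]
  refine Finset.prod_congr rfl fun r _ => ?_
  simp only [facetV, Matrix.of_apply, add_left_inj]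
  rw [mul_comm, zpow_mul, zpow_sub₀ (hx r)]
  split_ifs <;> simp

lemma sum_mul_facetV {n : ℕ} (lam : Fin (n + 1) → ℤ) (f : Fin (n + 1) → ℂ) (r : Fin n) :
    ∑ k, f k * (facetV (n + 1) lam r k : ℂ) =
      f r.succ * lam r.succ - f r.castSucc * lam r.castSucc := by
  have h₁ (k : Fin (n + 1)) : (r : ℕ) + 1 = k ↔ r.succ = k := by simp [Fin.ext_iff]
  have h₂ (k : Fin (n + 1)) : (r : ℕ) = k ↔ r.castSucc = k := by simp [Fin.ext_iff]
  simp only [facetV, Matrix.of_apply, h₁, h₂]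
  push_cast
  simp [mul_sub, Finset.sum_sub_distrib]

lemma prod_sign_eq_one_iff {N : ℕ} {lam : Fin N → ℤ} (hlam : ∀ k, lam k = 1 ∨ lam k = -1)
    (hsum : ∑ k, lam k = 0) : ∏ k, lam k = 1 ↔ 4 ∣ N := by
  have key (s : Finset (Fin N)) :
      ∃ b : ℕ, ∏ k ∈ s, lam k = (-1) ^ b ∧ ∑ k ∈ s, lam k = s.card - 2 * b := by
    induction s using Finset.induction_on with
    | empty => exact ⟨0, by simp⟩
    | insert a s ha ih =>
      obtain ⟨b, hp, hs⟩ := ih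
      rw [Finset.prod_insert ha, Finset.sum_insert ha, Finset.card_insert_of_notMem ha, hp, hs]
      rcases hlam a with h | h <;> rw [h]
      · exact ⟨b, by ring, by push_cast; ring⟩
      · exact ⟨b + 1, by ring, by push_cast; ring⟩
  obtain ⟨b, hp, hs⟩ := key Finset.univ
  rw [hsum, Finset.card_univ, Fintype.card_fin] at hs
  rw [hp, neg_one_pow_eq_one_iff_even (by decide), even_iff_two_dvd]
  omega

lemma prod_extendOne_div {n : ℕ} {x : Fin n → ℂ} (hx : ∀ j, x j ≠ 0) :
    ∏ k : Fin (n + 1), extendOne x k / extendOne x (k + 1) = 1 := by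
  rw [Fin.prod_univ_eq_prod_range (fun k => extendOne x k / extendOne x (k + 1)),
    ← inv_inj, ← Finset.prod_inv_distrib]
  simp only [inv_div]
  have h (m : ℕ) : ∏ k ∈ Finset.range m, extendOne x (k + 1) / extendOne x k = extendOne x m := by
    induction m with
    | zero => simp [extendOne_zero]
    | succ m ih =>
      rw [Finset.prod_range_succ, ih, mul_div_cancel₀ _ (extendOne_ne_zero hx m)]
  rw [h, extendOne_last, inv_one]

/-- The facet system says that all `λ_k x^{v_k}` agree. -/
lemma facet_system_iff {n : ℕ} {x : Fin n → ℂ} (hx : ∀ j, x j ≠ 0) (lam : Fin (n + 1) → ℤ) :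
    (∀ r : Fin n, ∑ k, mpow x (fun r' => facetV (n + 1) lam r' k) *
        (facetV (n + 1) lam r k : ℂ) = 0) ↔
      ∃ c : ℂ, ∀ k : Fin (n + 1),
        (extendOne x k / extendOne x (k + 1)) ^ lam k * lam k = c := by
  simp only [sum_mul_facetV, mpow_facetV hx, sub_eq_zero]
  constructor
  · intro h
    refine ⟨(extendOne x 0 / extendOne x (0 + 1)) ^ lam 0 * lam 0, fun k => ?_⟩
    induction k using Fin.induction with
    | zero => simp
    | succ r ih => rw [h r, ih]
  · rintro ⟨c, hc⟩ r
    rw [hc, hc]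

/-- for even `N ≥ 4` and a balanced sign vector `λ ∈ {−1,1}^N` with facet matrix
columns `v_1, …, v_N`, there exists `x ∈ (ℂ∖{0})^{N−1}` with `∑_{k=1}^N x^{v_k}·v_k = 0`
if and only if `4 ∣ N`. -/
theorem facet_initial_system_solvable_iff (N : ℕ) (hN : 4 ≤ N) (hEven : Even N)
    (lam : Fin N → ℤ) (hlam : ∀ k, lam k = 1 ∨ lam k = -1)
    (hsum : ∑ k, lam k = 0) :
    (∃ x : Fin (N - 1) → ℂ, (∀ j, x j ≠ 0) ∧
      ∀ r : Fin (N - 1),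
        (∑ k : Fin N, mpow x (fun r' => facetV N lam r' k) * (facetV N lam r k : ℂ)) = 0)
    ↔ 4 ∣ N := by
  obtain ⟨n, rfl⟩ : ∃ n, N = n + 1 := ⟨N - 1, by omega⟩
  rw [← prod_sign_eq_one_iff hlam hsum]
  constructor
  · rintro ⟨x, hx, h⟩
    obtain ⟨c, hc⟩ := (facet_system_iff hx lam).1 h
    have hc0 : c ≠ 0 := by
      rw [← hc 0]
      refine mul_ne_zero (zpow_ne_zero _ (div_ne_zero (extendOne_ne_zero hx _)
        (extendOne_ne_zero hx _))) ?_
      rcases hlam 0 with h0 | h0 <;> simp [h0]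
    have hquot (k : Fin (n + 1)) :
        extendOne x k / extendOne x (k + 1) = lam k * c ^ lam k := by
      rw [← hc k]
      rcases hlam k with hk | hk <;> simp [hk]
    have hprod : ∏ k : Fin (n + 1), extendOne x k / extendOne x (k + 1) = 1 :=
      prod_extendOne_div (n := n) hx
    simp_rw [hquot, Finset.prod_mul_distrib] at hprod
    have hpow (s : Finset (Fin (n + 1))) : ∏ k ∈ s, c ^ lam k = c ^ ∑ k ∈ s, lam k := by
      induction s using Finset.induction_on with
      | empty => simp
      | insert a s ha ih => rw [Finset.prod_insert ha, Finset.sum_insert ha, ih, zpow_add₀ hc0]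
    rw [hpow, hsum, zpow_zero, mul_one] at hprod
    exact_mod_cast hprod
  · intro hprod
    have hne (k) : (lam k : ℂ) ≠ 0 := by rcases hlam k with h | h <;> simp [h]
    let P : ℕ → ℂ := fun i => ∏ k : Fin (n + 1), if (k : ℕ) < i then (lam k : ℂ) else 1
    have hP0 (i) : P i ≠ 0 := Finset.prod_ne_zero_iff.2 fun k _ => by
      split_ifs
      exacts [hne k, one_ne_zero]
    have hPs (k : Fin (n + 1)) : P (k + 1) = P k * lam k := by
      have : (lam k : ℂ) = ∏ j, if j = k then (lam j : ℂ) else 1 := by simp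
      rw [this, ← Finset.prod_mul_distrib]
      refine Finset.prod_congr rfl fun j _ => ?_
      rcases lt_trichotomy j k with h | h | h
      · simp [h.ne, h, Nat.lt_succ_of_lt (Fin.lt_def.1 h)]
      · simp [h]
      · simp [h.ne', h.not_gt, h.not_ge]
    have hx : ∀ r : Fin n, P (r + 1) ≠ 0 := fun r => hP0 _
    refine ⟨fun r => P (r + 1), hx, (facet_system_iff hx lam).2 ⟨1, fun k => ?_⟩⟩
    have hext : ∀ i ≤ n + 1, extendOne (fun r : Fin n => P (r + 1)) i = P i := by
      intro i hi
      rcases Nat.eq_zero_or_pos i with rfl | hpos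
      · simp [extendOne_zero, P]
      rcases hi.eq_or_lt with rfl | hlt
      · rw [extendOne_last]
        simp only [P, Fin.is_lt, if_true]
        exact_mod_cast hprod.symm
      · obtain ⟨j, rfl⟩ : ∃ j, i = j + 1 := ⟨i - 1, by omega⟩
        exact extendOne_succ _ (⟨j, by omega⟩ : Fin n)
    rw [hext _ k.is_lt.le, hext _ k.is_lt, hPs, div_mul_cancel_left₀ (hP0 _)]
    rcases hlam k with h | h <;> simp [h]
end
end

section
/- Let N ≥ 3 be odd and n = N−1. Fix q ∈ {1,…,N} and signs ε_k ∈ {−1,1} for k ∈ {1,…,N}∖{q} with ∑_{k≠q} ε_k = 0, and let V be the n×n integer matrix whose columns are ε_k(e_{k−1} − e_k) for k ∈ {1,…,N}∖{q}, where e_1,…,e_n is the standard basis of ℤ^n and e_0 = e_N = 0. Then there exists a nonzero polynomial p in the variables (c_1,…,c_n, a, entries of an n×n matrix R) such that for every c ∈ ℂ^n, a ∈ ℂ∖{0}, and invertible complex n×n matrix R with p(c, a, R) ≠ 0, the facet subsystem determined by (c, a, R, V) has exactly one solution x ∈ (ℂ∖{0})^n. -/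
noncomputable section

/-- Column `k` (`k = 1, …, N`) of the matrix whose columns are `ε_k (e_{k-1} − e_k)`,
with `e_0 = e_N = 0`; rows are indexed by `Fin (N-1)`. -/
def facetCol (N : ℕ) (eps : Fin N → ℤ) (k : Fin N) : Fin (N - 1) → ℤ := fun r =>
  eps k * ((if (r : ℕ) + 1 = (k : ℕ) then 1 else 0) - (if (r : ℕ) = (k : ℕ) then 1 else 0))

/-- The coordinates of `x` shifted by one and padded by ones: `paddedCoord x 0 = 1`,
`paddedCoord x (r + 1) = x r` and `paddedCoord x k = 1` for `k > n`. -/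
def paddedCoord {n : ℕ} (x : Fin n → ℂ) (k : ℕ) : ℂ :=
  ∏ r : Fin n, if (r : ℕ) + 1 = k then x r else 1

theorem paddedCoord_zero {n : ℕ} (x : Fin n → ℂ) : paddedCoord x 0 = 1 := by
  simp [paddedCoord]

theorem paddedCoord_of_lt {n : ℕ} (x : Fin n → ℂ) {k : ℕ} (hk : n < k) :
    paddedCoord x k = 1 := by
  refine Finset.prod_eq_one fun r _ => if_neg ?_
  omega

theorem paddedCoord_succ {n : ℕ} (x : Fin n → ℂ) (r : Fin n) :
    paddedCoord x (r + 1) = x r := by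
  simp [paddedCoord, Fin.val_inj]

theorem paddedCoord_ne_zero {n : ℕ} {x : Fin n → ℂ} (hx : ∀ j, x j ≠ 0) (k : ℕ) :
    paddedCoord x k ≠ 0 := by
  refine Finset.prod_ne_zero_iff.2 fun r _ => ?_
  split_ifs
  exacts [hx r, one_ne_zero]

theorem mpow_facetCol {N : ℕ} (eps : Fin N → ℤ) (k : Fin N) {x : Fin (N - 1) → ℂ}
    (hx : ∀ j, x j ≠ 0) :
    mpow x (facetCol N eps k) = (paddedCoord x k / paddedCoord x (k + 1)) ^ eps k := by
  unfold mpow facetCol paddedCoord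
  rw [← Finset.prod_div_distrib, ← Finset.prod_zpow]
  refine Finset.prod_congr rfl fun r _ => ?_
  rw [mul_comm, zpow_mul, zpow_sub₀ (hx r)]
  congr 2 <;> (try simp only [add_left_inj]) <;> split_ifs <;> simp

/-- The partial sum of the entries of `b` of index less than `k`. -/
def partialSum {A : Type*} [CommRing A] {n : ℕ} (b : Fin n → A) (k : ℕ) : A :=
  ∑ r : Fin n, if (r : ℕ) < k then b r else 0

theorem partialSum_succ {A : Type*} [CommRing A] {n : ℕ} (b : Fin n → A) (r : Fin n) :
    partialSum b (r + 1) = partialSum b r + b r := by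
  have h : ∀ s : Fin n, (if (s : ℕ) < r + 1 then b s else 0) =
      (if (s : ℕ) < r then b s else 0) + if s = r then b s else 0 := by
    intro s
    rcases lt_trichotomy (s : ℕ) r with h | h | h
    · have : s ≠ r := by rintro rfl; omega
      simp [h, this, Nat.lt_succ_of_lt h]
    · have : s = r := Fin.ext h
      simp [this]
    · have h1 : s ≠ r := by rintro rfl; omega
      have h2 : ¬ (s : ℕ) < r + 1 := by omega
      have h3 : ¬ (s : ℕ) < r := by omega
      simp [h1, h2, h3]
  simp only [partialSum, h, Finset.sum_add_distrib, Finset.sum_ite_eq', Finset.mem_univ,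
    if_true]

theorem map_partialSum {A A' : Type*} [CommRing A] [CommRing A'] (f : A →+* A') {n : ℕ}
    (b : Fin n → A) (k : ℕ) : f (partialSum b k) = partialSum (f ∘ b) k := by
  simp [partialSum, map_sum, apply_ite f]

theorem partialSum_const_mul {A : Type*} [CommRing A] {n : ℕ} (d : A) (b : Fin n → A) (k : ℕ) :
    partialSum (fun r => d * b r) k = d * partialSum b k := by
  simp [partialSum, Finset.mul_sum]

/-- A sequence is determined by its consecutive differences up to a constant. -/
theorem sub_eq_partialSum_sub {A : Type*} [CommRing A] {N : ℕ} (w : Fin N → A)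
    (b : Fin (N - 1) → A)
    (h : ∀ r : Fin (N - 1), w ⟨r + 1, by omega⟩ - w ⟨r, by omega⟩ = b r) (k q : Fin N) :
    w k - w q = partialSum b k - partialSum b q := by
  have key : ∀ m (hm : m < N), w ⟨m, hm⟩ - partialSum b m =
      w ⟨0, by omega⟩ - partialSum b 0 := by
    intro m
    induction m with
    | zero => intro _; rfl
    | succ m ih =>
      intro hm
      have h1 := ih (by omega)
      have h2 := h ⟨m, by omega⟩
      have h3 := partialSum_succ b ⟨m, by omega⟩
      simp only at h2 h3
      linear_combination h1 + h2 - h3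
  linear_combination key k k.2 - key q q.2

theorem sum_facetCol_mul {N : ℕ} (q : Fin N) (eps : Fin N → ℤ) (m : Fin N → ℂ)
    (r : Fin (N - 1)) :
    ∑ k ∈ Finset.univ.erase q, (facetCol N eps k r : ℂ) * m k =
      (if (⟨r + 1, by omega⟩ : Fin N) = q then 0 else
        (eps ⟨r + 1, by omega⟩ : ℂ) * m ⟨r + 1, by omega⟩) -
      (if (⟨r, by omega⟩ : Fin N) = q then 0 else (eps ⟨r, by omega⟩ : ℂ) * m ⟨r, by omega⟩) := by
  set w : Fin N → ℂ := fun k => if k = q then 0 else (eps k : ℂ) * m k with hw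
  have h : ∑ k ∈ Finset.univ.erase q, (facetCol N eps k r : ℂ) * m k =
      ∑ k, ((if (⟨r + 1, by omega⟩ : Fin N) = k then w k else 0) -
        if (⟨r, by omega⟩ : Fin N) = k then w k else 0) := by
    rw [← Finset.add_sum_erase _ _ (Finset.mem_univ q)]
    have hq : w q = 0 := by simp [hw]
    rw [hq, ite_self, ite_self, sub_zero, zero_add]
    refine Finset.sum_congr rfl fun k hk => ?_
    have hk' : k ≠ q := (Finset.mem_erase.1 hk).1
    have hwk : w k = eps k * m k := if_neg hk'
    simp only [hwk, facetCol, Fin.ext_iff]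
    split_ifs <;> push_cast <;> ring
  rw [h, Finset.sum_sub_distrib]
  simp [hw]

/-- The ratios of consecutive padded coordinates other than the `q`-th one may be prescribed
freely, and they determine the coordinates. -/
theorem existsUnique_paddedCoord_div {N : ℕ} (q : Fin N) (s : ℕ → ℂ)
    (hs : ∀ k, k < N → k ≠ q → s k ≠ 0) :
    ∃! x : Fin (N - 1) → ℂ, (∀ j, x j ≠ 0) ∧
      ∀ k : Fin N, k ≠ q → paddedCoord x k / paddedCoord x (k + 1) = s k := by
  have hqN := q.2
  let X : ℕ → ℂ := fun k =>
    if k ≤ q then ∏ j ∈ Finset.range k, (s j)⁻¹ else ∏ j ∈ Finset.Ico k N, s j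
  have hX : ∀ k, X k ≠ 0 := by
    intro k
    simp only [X]
    split_ifs with h
    · refine Finset.prod_ne_zero_iff.2 fun j hj => inv_ne_zero ?_
      rw [Finset.mem_range] at hj
      exact hs j (by omega) (by omega)
    · refine Finset.prod_ne_zero_iff.2 fun j hj => ?_
      rw [Finset.mem_Ico] at hj
      exact hs j (by omega) (by omega)
  refine ⟨fun r => X (r + 1), ⟨fun _ => hX _, ?_⟩, ?_⟩
  · have hpad : ∀ k, k ≤ N → paddedCoord (fun r : Fin (N - 1) => X (r + 1)) k = X k := by
      intro k hk
      rcases k with _ | k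
      · simp [paddedCoord_zero, X]
      · by_cases hkN : k < N - 1
        · exact paddedCoord_succ (fun r : Fin (N - 1) => X (r + 1)) ⟨k, hkN⟩
        · have : k + 1 = N := by omega
          rw [paddedCoord_of_lt _ (by omega), this]
          simp [X, hqN]
    intro k hk
    have hkq : (k : ℕ) ≠ q := fun h => hk (Fin.ext h)
    have hsk := hs k k.2 hkq
    rw [hpad k k.2.le, hpad (k + 1) k.2, div_eq_iff (hX _)]
    by_cases h : (k : ℕ) ≤ q
    · have h' : (k : ℕ) + 1 ≤ q := by omega
      simp only [X, h, h', if_true, Finset.prod_range_succ]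
      field_simp
    · have h' : ¬ (k : ℕ) + 1 ≤ q := by omega
      simp only [X, h, h', if_false]
      exact Finset.prod_eq_prod_Ico_succ_bot k.2 _
  · rintro x ⟨hx, hxs⟩
    have hne := paddedCoord_ne_zero hx
    have hle : ∀ k, k ≤ (q : ℕ) → paddedCoord x k = X k := by
      intro k
      induction k with
      | zero => intro _; simp [paddedCoord_zero, X]
      | succ k ih =>
        intro hk
        have h1 := hxs ⟨k, by omega⟩ (by rw [Ne, Fin.ext_iff]; simp only; omega)
        have h2 := hs k (by omega) (by omega)
        rw [div_eq_iff (hne _), ih (by omega)] at h1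
        have h3 : X (k + 1) = X k * (s k)⁻¹ := by
          simp only [X, hk, (by omega : k ≤ (q : ℕ)), if_true, Finset.prod_range_succ]
        simp only at h1
        rw [h3, h1]
        field_simp
    have hgt : ∀ d k, k + d = N → (q : ℕ) < k → paddedCoord x k = X k := by
      intro d
      induction d with
      | zero =>
        intro k hk hq
        rw [paddedCoord_of_lt x (by omega)]
        have : k = N := by omega
        simp [X, this, hqN]
      | succ d ih =>
        intro k hk hq
        have h1 := hxs ⟨k, by omega⟩ (by rw [Ne, Fin.ext_iff]; simp only; omega)
        rw [div_eq_iff (hne _)] at h1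
        simp only at h1
        rw [h1, ih (k + 1) (by omega) (by omega)]
        simp only [X]
        rw [if_neg (by omega), if_neg (by omega),
          Finset.prod_eq_prod_Ico_succ_bot (by omega : k < N)]
    funext r
    rw [← paddedCoord_succ x r]
    by_cases h : (r : ℕ) + 1 ≤ q
    · exact hle _ h
    · exact hgt (N - (r + 1)) _ (by omega) (by omega)

/-- The facet subsystem, solved for its monomials. -/
theorem facet_subsystem_iff {N : ℕ} (q : Fin N) (eps : Fin N → ℤ)
    (heps : ∀ k, k ≠ q → eps k = 1 ∨ eps k = -1) (c : Fin (N - 1) → ℂ) {a : ℂ}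
    {R : Matrix (Fin (N - 1)) (Fin (N - 1)) ℂ} (ha : a ≠ 0) (hR : IsUnit R) (m : Fin N → ℂ) :
    (∀ i, c i = a * ∑ k ∈ Finset.univ.erase q,
        (∑ r, R i r * (facetCol N eps k r : ℂ)) * m k) ↔
      ∀ k, k ≠ q → m k = eps k * ((a * R.det)⁻¹ *
        (partialSum (R.adjugate.mulVec c) k - partialSum (R.adjugate.mulVec c) q)) := by
  have hdet : R.det ≠ 0 := ((Matrix.isUnit_iff_isUnit_det R).1 hR).ne_zero
  set u := R.adjugate.mulVec c with hu
  set w : Fin N → ℂ := fun k => if k = q then 0 else (eps k : ℂ) * m k with hw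
  set Δ : Fin (N - 1) → ℂ := fun r => w ⟨r + 1, by omega⟩ - w ⟨r, by omega⟩ with hΔ
  have hsys : ∀ i, a * ∑ k ∈ Finset.univ.erase q,
      (∑ r, R i r * (facetCol N eps k r : ℂ)) * m k = (a • R.mulVec Δ) i := by
    intro i
    simp only [Pi.smul_apply, smul_eq_mul, Matrix.mulVec, dotProduct]
    congr 1
    simp only [Finset.sum_mul]
    rw [Finset.sum_comm]
    refine Finset.sum_congr rfl fun r _ => ?_
    simp only [mul_assoc]
    rw [← Finset.mul_sum, sum_facetCol_mul]
  have hiff : (∀ i, c i = (a • R.mulVec Δ) i) ↔ ∀ r, Δ r = (a * R.det)⁻¹ * u r := by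
    constructor
    · intro h r
      have hc : c = a • R.mulVec Δ := funext h
      have : u = (a * R.det) • Δ := by
        rw [hu, hc, Matrix.mulVec_smul, Matrix.mulVec_mulVec, Matrix.adjugate_mul,
          Matrix.smul_mulVec, Matrix.one_mulVec, smul_smul]
      rw [this, Pi.smul_apply, smul_eq_mul]
      field_simp
    · intro h i
      have hΔu : Δ = (a * R.det)⁻¹ • u := funext h
      have : a • R.mulVec Δ = c := by
        rw [hΔu, hu, Matrix.mulVec_smul, Matrix.mulVec_mulVec, Matrix.mul_adjugate,
          Matrix.smul_mulVec, Matrix.one_mulVec, smul_smul, smul_smul]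
        have : a * ((a * R.det)⁻¹ * R.det) = 1 := by field_simp
        rw [mul_assoc, this, one_smul]
      rw [this]
  have heps2 : ∀ k, k ≠ q → (eps k : ℂ) * eps k = 1 := by
    intro k hk
    rcases heps k hk with h | h <;> simp [h]
  simp only [hsys]
  rw [hiff]
  have hwq : w q = 0 := by simp [hw]
  constructor
  · intro h k hk
    have := sub_eq_partialSum_sub w _ h k q
    rw [partialSum_const_mul, partialSum_const_mul, hwq, ← mul_sub, sub_zero] at this
    rw [← this]
    simp only [hw, hk, if_false]
    rw [← mul_assoc, heps2 k hk, one_mul]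
  · intro h r
    have hall : ∀ k, w k = (a * R.det)⁻¹ * (partialSum u k - partialSum u q) := by
      intro k
      by_cases hk : k = q
      · rw [hk, hwq, sub_self, mul_zero]
      · simp only [hw, hk, if_false]
        rw [h k hk, ← mul_assoc, heps2 k hk, one_mul]
    simp only [hΔ, hall]
    rw [partialSum_succ]
    ring

/-- for odd `N ≥ 3`, `n = N−1`, an omitted edge `q` and balanced signs
`ε_k ∈ {−1,1}` for `k ≠ q`, the `n×n` facet matrix `V` has columns `ε_k(e_{k−1} − e_k)`,
`k ≠ q`; there is a nonzero polynomial `p` in `(c, a, R)` such that for every `c ∈ ℂ^n`,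
`a ∈ ℂ∖{0}`, and invertible `R` with `p(c, a, R) ≠ 0`, the facet subsystem
`c_i = a·∑_{k ≠ q} (RV)_{ik}·x^{v_k}` has exactly one solution `x ∈ (ℂ∖{0})^n`. -/
theorem odd_facet_subsystem_unique_solution (N : ℕ) (hN : 3 ≤ N) (hodd : Odd N)
    (q : Fin N) (eps : Fin N → ℤ)
    (heps : ∀ k, k ≠ q → eps k = 1 ∨ eps k = -1)
    (hsum : ∑ k ∈ Finset.univ.erase q, eps k = 0) :
    ∃ p : MvPolynomial (Fin (N - 1) ⊕ Unit ⊕ (Fin (N - 1) × Fin (N - 1))) ℂ, p ≠ 0 ∧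
      ∀ (c : Fin (N - 1) → ℂ) (a : ℂ) (R : Matrix (Fin (N - 1)) (Fin (N - 1)) ℂ),
        a ≠ 0 → IsUnit R →
        MvPolynomial.eval
            (Sum.elim c (Sum.elim (fun _ => a) (fun ij => R ij.1 ij.2))) p ≠ 0 →
        ∃! x : Fin (N - 1) → ℂ, (∀ j, x j ≠ 0) ∧
          ∀ i, c i = a * ∑ k ∈ Finset.univ.erase q,
            (∑ r, R i r * (facetCol N eps k r : ℂ)) * mpow x (facetCol N eps k) := by
  classical
  let S := MvPolynomial (Fin (N - 1) ⊕ Unit ⊕ (Fin (N - 1) × Fin (N - 1))) ℂ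
  let cS : Fin (N - 1) → S := fun i => MvPolynomial.X (Sum.inl i)
  let RS : Matrix (Fin (N - 1)) (Fin (N - 1)) S :=
    Matrix.of fun i j => MvPolynomial.X (Sum.inr (Sum.inr (i, j)))
  let uS : Fin (N - 1) → S := RS.adjugate.mulVec cS
  have heval : ∀ (c : Fin (N - 1) → ℂ) (a : ℂ) (R : Matrix (Fin (N - 1)) (Fin (N - 1)) ℂ),
      MvPolynomial.eval (Sum.elim c (Sum.elim (fun _ => a) (fun ij => R ij.1 ij.2)))
        (∏ k ∈ Finset.univ.erase q, (partialSum uS k - partialSum uS q)) =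
      ∏ k ∈ Finset.univ.erase q, (partialSum (R.adjugate.mulVec c) k -
        partialSum (R.adjugate.mulVec c) q) := by
    intro c a R
    set f := MvPolynomial.eval (Sum.elim c (Sum.elim (fun _ : Unit => a)
      (fun ij : Fin (N - 1) × Fin (N - 1) => R ij.1 ij.2))) with hf
    have hR : f.mapMatrix RS = R := by
      ext i j
      simp [RS, hf]
    have hc : f ∘ cS = c := by
      ext i
      simp [cS, hf]
    have hu : f ∘ uS = R.adjugate.mulVec c := by
      ext i
      simp only [uS, Function.comp_apply]
      rw [RingHom.map_mulVec, ← RingHom.mapMatrix_apply, RingHom.map_adjugate, hR, hc]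
    rw [map_prod]
    simp only [map_sub, map_partialSum, hu]
  refine ⟨∏ k ∈ Finset.univ.erase q, (partialSum uS k - partialSum uS q), ?_, ?_⟩
  · intro h0
    have h1 := heval 1 1 1
    rw [h0, map_zero, Matrix.adjugate_one, Matrix.one_mulVec] at h1
    obtain ⟨k, hk, hk0⟩ := Finset.prod_eq_zero_iff.1 h1.symm
    rw [← sub_eq_partialSum_sub (fun k : Fin N => ((k : ℕ) : ℂ)) 1 (by simp) k q,
      sub_eq_zero] at hk0
    exact (Finset.mem_erase.1 hk).1 (Fin.ext (by exact_mod_cast hk0))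
  · intro c a R ha hR hp
    rw [heval, Finset.prod_ne_zero_iff] at hp
    have hdet : R.det ≠ 0 := ((Matrix.isUnit_iff_isUnit_det R).1 hR).ne_zero
    set t : Fin N → ℂ := fun k => eps k * ((a * R.det)⁻¹ *
      (partialSum (R.adjugate.mulVec c) k - partialSum (R.adjugate.mulVec c) q)) with ht
    have ht0 : ∀ k, k ≠ q → t k ≠ 0 := by
      intro k hk
      have h1 : (eps k : ℂ) ≠ 0 := by rcases heps k hk with h | h <;> simp [h]
      exact mul_ne_zero h1 (mul_ne_zero (inv_ne_zero (mul_ne_zero ha hdet))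
        (hp k (Finset.mem_erase.2 ⟨hk, Finset.mem_univ k⟩)))
    let s : ℕ → ℂ := fun k => if h : k < N then t ⟨k, h⟩ ^ eps ⟨k, h⟩ else 1
    have hs : ∀ k : Fin N, s k = t k ^ eps k := fun k => by simp [s]
    have hex := existsUnique_paddedCoord_div q s (by
      intro k hk hkq
      rw [hs ⟨k, hk⟩]
      exact zpow_ne_zero _ (ht0 _ fun h => hkq (Fin.ext_iff.1 h)))
    refine (existsUnique_congr fun x => and_congr_right fun hx => ?_).2 hex
    rw [facet_subsystem_iff q eps heps c ha hR]
    refine forall_congr' fun k => forall_congr' fun hk => ?_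
    rw [mpow_facetCol eps k hx, hs k]
    change _ = t k ↔ _
    rcases heps k hk with h | h
    · rw [h, zpow_one, zpow_one]
    · rw [h, zpow_neg_one, zpow_neg_one, inv_eq_iff_eq_inv]
end
end
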